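/- Let E be a real inner product space (e.g., EuclideanSpace ℝ (Fin p)), let V be a finite set of sensors with positions given by x : V → E, let 𝓔 ⊆ V × V be a finite set of edges with range measurements d : 𝓔 → ℝ, let A be a finite set of anchors with positions a : A → E, let 𝓐 ⊆ V × A be a finite set of sensor–anchor pairs with range measurements r : 𝓐 → ℝ, and let R : 𝓔 → (0,∞) and R' : 𝓐 → (0,∞) assign Huber parameters to edges. Then the relaxed cost f(x) = Σ_{(i,j)∈𝓔} h_{R(i,j)}(max(0, ‖x_i − x_j‖ − d_{ij})) + Σ_{(i,k)∈𝓐} h_{R'(i,k)}(max(0, ‖x_i − a_k‖ − r_{ik})) is a convex function of x on the product space V → E. -/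

import Mathlib

/-- The Huber loss function with parameter `R`. -/
noncomputable def huber (R t : ℝ) : ℝ :=
  if |t| ≤ R then t ^ 2 else 2 * R * |t| - R ^ 2

theorem two_mul_sub_sq_le_huber {R s : ℝ} (hs : |s| ≤ R) (t : ℝ) :
    2 * s * t - s ^ 2 ≤ huber R t := by
  unfold huber
  split_ifs with ht
  · nlinarith [sq_nonneg (s - t)]
  · have hst : s * t ≤ |s| * |t| := (le_abs_self _).trans_eq (abs_mul s t)
    nlinarith [sq_abs s, mul_nonneg (sub_nonneg.2 hs) (sub_nonneg.2 (not_le.1 ht).le),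
      sq_nonneg (R - |s|)]

theorem exists_huber_eq_of_nonneg {R t : ℝ} (hR : 0 ≤ R) (ht : 0 ≤ t) :
    ∃ s, 0 ≤ s ∧ s ≤ R ∧ huber R t = 2 * s * t - s ^ 2 := by
  unfold huber
  rw [abs_of_nonneg ht]
  split_ifs with h
  · exact ⟨t, ht, h, by ring⟩
  · exact ⟨R, hR, le_rfl, rfl⟩

theorem convexOn_huber {R : ℝ} (hR : 0 ≤ R) : ConvexOn ℝ (Set.Ici 0) (huber R) := by
  refine ⟨convex_Ici 0, fun x hx y hy α β hα hβ hαβ => ?_⟩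
  obtain ⟨s, hs, hsR, h⟩ :=
    exists_huber_eq_of_nonneg hR (convex_Ici (0 : ℝ) hx hy hα hβ hαβ)
  have habs : |s| ≤ R := (abs_of_nonneg hs).trans_le hsR
  rw [h]
  simp only [smul_eq_mul]
  calc 2 * s * (α * x + β * y) - s ^ 2
      = α * (2 * s * x - s ^ 2) + β * (2 * s * y - s ^ 2) := by
        linear_combination s ^ 2 * hαβ
    _ ≤ α * huber R x + β * huber R y := by
        gcongr <;> exact two_mul_sub_sq_le_huber habs _

theorem monotoneOn_huber {R : ℝ} (hR : 0 ≤ R) : MonotoneOn (huber R) (Set.Ici 0) := by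
  intro x hx y _ hxy
  obtain ⟨s, hs, hsR, h⟩ := exists_huber_eq_of_nonneg hR hx
  rw [h]
  refine le_trans ?_ (two_mul_sub_sq_le_huber ((abs_of_nonneg hs).trans_le hsR) y)
  gcongr

theorem ConvexOn.huber_max_zero {F : Type*} [AddCommGroup F] [Module ℝ F] {S : Set F}
    {f : F → ℝ} (hf : ConvexOn ℝ S f) {R : ℝ} (hR : 0 ≤ R) :
    ConvexOn ℝ S (fun x => huber R (max 0 (f x))) := by
  have hg : ConvexOn ℝ S (fun x => max 0 (f x)) := (convexOn_const 0 hf.1).sup hf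
  refine ⟨hf.1, fun x hx y hy α β hα hβ hαβ => ?_⟩
  have hx0 : max 0 (f x) ∈ Set.Ici (0 : ℝ) := Set.mem_Ici.2 (le_max_left _ _)
  have hy0 : max 0 (f y) ∈ Set.Ici (0 : ℝ) := Set.mem_Ici.2 (le_max_left _ _)
  exact (monotoneOn_huber hR (Set.mem_Ici.2 (le_max_left _ _))
    (convex_Ici (0 : ℝ) hx0 hy0 hα hβ hαβ) (hg.2 hx hy hα hβ hαβ)).trans
    ((convexOn_huber hR).2 hx0 hy0 hα hβ hαβ)

theorem ConvexOn.finset_sum {F ι : Type*} [AddCommGroup F] [Module ℝ F] {S : Set F}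
    (hS : Convex ℝ S) (s : Finset ι) {f : ι → F → ℝ} (hf : ∀ i ∈ s, ConvexOn ℝ S (f i)) :
    ConvexOn ℝ S (fun x => ∑ i ∈ s, f i x) := by
  refine ⟨hS, fun x hx y hy α β hα hβ hαβ => ?_⟩
  simp only [Finset.smul_sum, ← Finset.sum_add_distrib]
  exact Finset.sum_le_sum fun i hi => (hf i hi).2 hx hy hα hβ hαβ


/-- The relaxed network localization cost
`f(x) = Σ_{(i,j)∈𝓔} h_{R(i,j)}(max(0, ‖x_i − x_j‖ − d_{ij}))
      + Σ_{(i,k)∈𝓐} h_{R'(i,k)}(max(0, ‖x_i − a_k‖ − r_{ik}))`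
is a convex function of the configuration `x : V → E`. -/
theorem relaxed_cost_convexOn
    {E : Type*} [NormedAddCommGroup E] [InnerProductSpace ℝ E]
    {V A : Type*} [Fintype V] [Fintype A]
    (𝓔 : Finset (V × V)) (𝓐 : Finset (V × A))
    (d : V × V → ℝ) (r : V × A → ℝ) (a : A → E)
    (R : V × V → ℝ) (R' : V × A → ℝ)
    (hR : ∀ e ∈ 𝓔, 0 < R e) (hR' : ∀ e ∈ 𝓐, 0 < R' e) :
    ConvexOn ℝ Set.univ (fun x : V → E =>
      (∑ e ∈ 𝓔, huber (R e) (max 0 (‖x e.1 - x e.2‖ - d e))) +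
      (∑ e ∈ 𝓐, huber (R' e) (max 0 (‖x e.1 - a e.2‖ - r e)))) := by
  refine (ConvexOn.finset_sum convex_univ 𝓔 fun e he => ?_).add
    (ConvexOn.finset_sum convex_univ 𝓐 fun e he => ?_)
  · refine ConvexOn.huber_max_zero (ConvexOn.add_const ?_ (-d e)) (hR e he).le
    exact convexOn_univ_norm.comp_linearMap
      (LinearMap.proj (R := ℝ) (φ := fun _ : V => E) e.1 - LinearMap.proj e.2)
  · refine ConvexOn.huber_max_zero (ConvexOn.add_const ?_ (-r e)) (hR' e he).le
    have h : ConvexOn ℝ Set.univ (fun z : E => ‖z - a e.2‖) := by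
      simpa only [dist_eq_norm] using convexOn_univ_dist (a e.2)
    exact h.comp_linearMap (LinearMap.proj (R := ℝ) (φ := fun _ : V => E) e.1)
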